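/- Let h, e ∈ g satisfy [h, e] = 2e, let P : g → g be ad-equivariant, and let Q : g → g be ad-equivariant and homogeneous of degree m_Q ≥ 1. Set y = dP(e).h and z = Q(e). Then [y, z] = 2m_Q · dP(e).Q(e). -/

import Mathlib

section AdEquivariant

variable {g : Type*} [NormedAddCommGroup g] [NormedSpace ℂ g]

/-- A bilinear product rule for two maps whose pointwise bracket vanishes. -/
theorem lie_fderiv_add_lie_fderiv_eq_zero [FiniteDimensional ℂ g]
    (lie : g →ₗ[ℂ] g →ₗ[ℂ] g) {P Q : g → g} (hPQ : ∀ x, lie (P x) (Q x) = 0) {x : g}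
    (hP : DifferentiableAt ℂ P x) (hQ : DifferentiableAt ℂ Q x) (v : g) :
    lie (fderiv ℂ P x v) (Q x) + lie (P x) (fderiv ℂ Q x v) = 0 := by
  have hd := lie.toContinuousBilinearMap.hasFDerivAt_of_bilinear hP.hasFDerivAt hQ.hasFDerivAt
  have hc : (fun y => lie.toContinuousBilinearMap (P y) (Q y)) = fun _ => 0 := funext hPQ
  rw [hc] at hd
  have hv := congrArg (fun L : g →L[ℂ] g => L v) (hd.unique (hasFDerivAt_const 0 x))
  simpa [add_comm] using hv

/-- Euler's identity for a homogeneous map. -/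
theorem fderiv_apply_self_of_homogeneous {Q : g → g} {m : ℕ}
    (hhom : ∀ (t : ℂ) (x : g), Q (t • x) = t ^ m • Q x) {x : g}
    (hQ : DifferentiableAt ℂ Q x) : fderiv ℂ Q x x = (m : ℂ) • Q x := by
  have hline : HasDerivAt (fun t : ℂ => t • x) x 1 := by
    simpa using (hasDerivAt_id (1 : ℂ)).smul_const x
  have hQ' : HasFDerivAt Q (fderiv ℂ Q x) ((1 : ℂ) • x) := by
    simpa using hQ.hasFDerivAt
  have hcomp : HasDerivAt (fun t : ℂ => t ^ m • Q x) (fderiv ℂ Q x x) 1 := by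
    simpa only [Function.comp_def, hhom] using hQ'.comp_hasDerivAt (1 : ℂ) hline
  have hpow : HasDerivAt (fun t : ℂ => t ^ m • Q x) ((m : ℂ) • Q x) 1 := by
    simpa using (hasDerivAt_pow m (1 : ℂ)).smul_const (Q x)
  exact hcomp.unique hpow

end AdEquivariant


theorem stmt {g : Type*} [NormedAddCommGroup g] [NormedSpace ℂ g] [FiniteDimensional ℂ g]
    -- `lie` is the Lie bracket of the finite-dimensional complex Lie algebra `g`,
    -- given as bilinear data so that it is compatible with the normed space structure.
    (lie : g →ₗ[ℂ] g →ₗ[ℂ] g)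
    (lie_self : ∀ x : g, lie x x = 0)
    (lie_jacobi : ∀ x y z : g, lie x (lie y z) = lie (lie x y) z + lie y (lie x z))
    (h e : g) (hhe : lie h e = (2 : ℂ) • e)
    (P : g → g) (hP : ContDiff ℂ ⊤ P)
    (hPeq : ∀ x y : g, fderiv ℂ P x (lie y x) = lie y (P x))
    (Q : g → g) (hQ : ContDiff ℂ ⊤ Q)
    (hQeq : ∀ x y : g, fderiv ℂ Q x (lie y x) = lie y (Q x))
    (mQ : ℕ) (hmQ : 1 ≤ mQ)
    (hQhom : ∀ (t : ℂ) (x : g), Q (t • x) = t ^ mQ • Q x) :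
    lie (fderiv ℂ P e h) (Q e) = (2 * (mQ : ℂ)) • fderiv ℂ P e (Q e) := by
  have skew (x y : g) : lie x y = -lie y x := by
    have hxy := lie_self (x + y)
    simp only [map_add, LinearMap.add_apply, lie_self, zero_add, add_zero] at hxy
    exact eq_neg_of_add_eq_zero_right hxy
  have hPd : DifferentiableAt ℂ P e := hP.differentiable (by simp) e
  have hQd : DifferentiableAt ℂ Q e := hQ.differentiable (by simp) e
  have hPx (x : g) : lie (P x) x = 0 := by
    rw [skew, ← hPeq, lie_self, map_zero, neg_zero]
  have hQx (x : g) : lie (Q x) x = 0 := by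
    rw [skew, ← hQeq, lie_self, map_zero, neg_zero]
  have hPQ (x : g) : lie (P x) (Q x) = 0 := by
    rw [← hQeq, hPx, map_zero]
  have hQe : lie (fderiv ℂ Q e h) e = (2 * (mQ : ℂ)) • Q e := by
    have hprod := lie_fderiv_add_lie_fderiv_eq_zero lie hQx hQd differentiableAt_fun_id h
    rw [fderiv_fun_id, ContinuousLinearMap.id_apply] at hprod
    rw [eq_neg_of_add_eq_zero_left hprod, ← skew, ← hQeq, hhe, map_smul,
      fderiv_apply_self_of_homogeneous hQhom hQd, smul_smul]
  rw [eq_neg_of_add_eq_zero_left (lie_fderiv_add_lie_fderiv_eq_zero lie hPQ hPd hQd h),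
    ← skew, ← hPeq, hQe, map_smul]
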